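/- arXiv:1812.09752 — 2 statements merged into one kernel-verified Lean document; each statement's English description precedes it below -/
import Mathlib

section
/- For every integer n ≥ 5, HG_lin(C_n) ≤ 2; that is, for every prime power q ≥ 3, the cycle C_n on n vertices admits no winning linear guessing strategy over F_q. -/
/-- A graph (given by its adjacency relation on a finite vertex type) is linearly solvable
over the field `F` if there is a winning guessing strategy in which every vertex `v` guesses
an affine function `x ↦ ∑ u, a v u * x u + b v` of the colors of its neighbors
(so `a v u = 0` whenever `v` does not see `u`). -/
def LinearSolvable {V : Type*} [Fintype V] (Adj : V → V → Prop) (F : Type*) [Field F] : Prop :=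
  ∃ (a : V → V → F) (b : V → F),
    (∀ v u : V, ¬ Adj v u → a v u = 0) ∧
    ∀ x : V → F, ∃ v : V, x v = (∑ u : V, a v u * x u) + b v

namespace HatCycle

lemma exists_avoid {F : Type*} [Fintype F] (S : Finset F) (h : S.card < Fintype.card F) :
    ∃ y, y ∉ S := by
  classical
  by_contra hc
  push Not at hc
  have : S = Finset.univ := by ext y; simp [hc y]
  rw [this, Finset.card_univ] at h
  exact lt_irrefl _ h

lemma avoid2 {F : Type*} [Fintype F] (hF : 3 ≤ Fintype.card F) (a b : F) :
    ∃ y, y ≠ a ∧ y ≠ b := by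
  classical
  obtain ⟨y, hy⟩ := exists_avoid ({a, b} : Finset F) (lt_of_le_of_lt Finset.card_le_two (by omega))
  simp at hy
  exact ⟨y, hy.1, hy.2⟩

lemma avoid3 {F : Type*} [Fintype F] (hF : 4 ≤ Fintype.card F) (a b c : F) :
    ∃ y, y ≠ a ∧ y ≠ b ∧ y ≠ c := by
  classical
  obtain ⟨y, hy⟩ := exists_avoid ({a, b, c} : Finset F)
    (lt_of_le_of_lt Finset.card_le_three (by omega))
  simp at hy
  exact ⟨y, hy.1, hy.2.1, hy.2.2⟩

lemma nonzero_affine {F : Type*} [Field F] [Fintype F] (hF : 3 ≤ Fintype.card F) (c s : F)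
    (hc : c ≠ 0) : ∃ y, y ≠ 0 ∧ c * y ≠ s := by
  obtain ⟨y, h0, h1⟩ := avoid2 hF 0 (s / c)
  refine ⟨y, h0, fun h => h1 ?_⟩
  rw [← h]; field_simp

/-- One-dimensional avoidance. -/
lemma pair_avoid {F : Type*} [Field F] [Fintype F] (hF : 3 ≤ Fintype.card F) (c d s : F)
    (h : c ≠ 0 ∨ d ≠ 0) : ∃ y z, y ≠ 0 ∧ z ≠ 0 ∧ c * y + d * z ≠ s := by
  rcases h with h | h
  · obtain ⟨y, h0, h1⟩ := nonzero_affine hF c (s - d) h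
    exact ⟨y, 1, h0, one_ne_zero, fun h => h1 (by linear_combination h)⟩
  · obtain ⟨y, h0, h1⟩ := nonzero_affine hF d (s - c) h
    exact ⟨1, y, one_ne_zero, h0, fun h => h1 (by linear_combination h)⟩

lemma line_case {F : Type*} [Field F] [Fintype F] (hF : 3 ≤ Fintype.card F) (t1 t2 t3 t4 s : F)
    (h : t1 ≠ 0 ∨ t2 ≠ 0) (h' : t3 ≠ 0 ∨ t4 ≠ 0) :
    ∃ y1 y2 y3 y4, y1 ≠ 0 ∧ y2 ≠ 0 ∧ y3 ≠ 0 ∧ y4 ≠ 0 ∧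
      y1 * t1 + y2 * t2 + y3 * t3 + y4 * t4 = s := by
  rcases h with h | h
  · obtain ⟨y, z, hy, hz, hs⟩ := pair_avoid hF t3 t4 (s - t2) h'
    refine ⟨(s - t2 - (t3 * y + t4 * z)) / t1, 1, y, z,
      div_ne_zero (sub_ne_zero.2 hs.symm) h, one_ne_zero, hy, hz, ?_⟩
    field_simp
    ring
  · obtain ⟨y, z, hy, hz, hs⟩ := pair_avoid hF t3 t4 (s - t1) h'
    refine ⟨1, (s - t1 - (t3 * y + t4 * z)) / t2, y, z, one_ne_zero,
      div_ne_zero (sub_ne_zero.2 hs.symm) h, hy, hz, ?_⟩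
    field_simp
    ring

lemma plane_case {F : Type*} [Field F] [Fintype F] (hF : 3 ≤ Fintype.card F)
    (a3 b3 a4 b4 a5 b5 s t : F) (h3 : a3 ≠ 0) (h34 : a3 * b4 - a4 * b3 ≠ 0)
    (h45 : a4 * b5 - a5 * b4 ≠ 0) :
    ∃ y3 y4 y5, y3 ≠ 0 ∧ y4 ≠ 0 ∧ y5 ≠ 0 ∧ s - (y3 * a3 + y4 * a4 + y5 * a5) ≠ 0 ∧
      t - (y3 * b3 + y4 * b4 + y5 * b5) ≠ 0 := by
  by_cases hb : b3 = 0
  · subst hb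
    have hb4 : b4 ≠ 0 := by rintro rfl; simp at h34
    obtain ⟨y4, h40, h41⟩ := nonzero_affine hF b4 (t - b5) hb4
    obtain ⟨y3, h30, h31⟩ := nonzero_affine hF a3 (s - a5 - y4 * a4) h3
    exact ⟨y3, y4, 1, h30, h40, one_ne_zero, fun h => h31 (by linear_combination -h),
      fun h => h41 (by linear_combination -h)⟩
  by_cases h4 : 4 ≤ Fintype.card F
  · obtain ⟨y, h0, h1, h2⟩ := avoid3 h4 0 ((s - a4 - a5) / a3) ((t - b4 - b5) / b3)
    refine ⟨y, 1, 1, h0, one_ne_zero, one_ne_zero, fun h => h1 ?_, fun h => h2 ?_⟩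
    · field_simp; linear_combination -h
    · field_simp; linear_combination -h
  · have hc : Fintype.card F = 3 := by omega
    have h3' : (3 : F) = 0 := by
      have := Nat.cast_card_eq_zero F
      rw [hc] at this
      exact_mod_cast this
    have h2 : (2 : F) ≠ 0 := fun h => one_ne_zero (α := F) (by linear_combination h3' - h)
    have key : ∃ y4 y5 : F, y4 ≠ 0 ∧ y5 ≠ 0 ∧
        (s - y4 * a4 - y5 * a5) * b3 + (t - y4 * b4 - y5 * b5) * a3 ≠ 0 := by
      by_contra hcon
      push Not at hcon
      have e1 := hcon 1 1 one_ne_zero one_ne_zero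
      have e2 := hcon 1 (-1) one_ne_zero (neg_ne_zero.2 one_ne_zero)
      have e3 := hcon (-1) 1 (neg_ne_zero.2 one_ne_zero) one_ne_zero
      have f5 : a5 * b3 + b5 * a3 = 0 := by
        apply (mul_eq_zero.1 _).resolve_left h2
        linear_combination e2 - e1
      have f4 : a4 * b3 + b4 * a3 = 0 := by
        apply (mul_eq_zero.1 _).resolve_left h2
        linear_combination e3 - e1
      apply h45
      apply (mul_eq_zero.1 _).resolve_left h3
      linear_combination a4 * f5 - a5 * f4
    obtain ⟨y4, y5, h40, h50, hk⟩ := key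
    by_contra hcon
    push Not at hcon
    have c1 := hcon 1 y4 y5 one_ne_zero h40 h50
    have c2 := hcon (-1) y4 y5 (neg_ne_zero.2 one_ne_zero) h40 h50
    by_cases d1 : s - (1 * a3 + y4 * a4 + y5 * a5) = 0
    · by_cases d2 : s - (-1 * a3 + y4 * a4 + y5 * a5) = 0
      · apply h3
        apply (mul_eq_zero.1 _).resolve_left h2
        linear_combination d2 - d1
      · have := c2 d2
        apply hk
        linear_combination b3 * d1 + a3 * this
    · have := c1 d1
      by_cases d2 : s - (-1 * a3 + y4 * a4 + y5 * a5) = 0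
      · apply hk
        linear_combination b3 * d2 + a3 * this
      · have h' := c2 d2
        apply hb
        apply (mul_eq_zero.1 _).resolve_left h2
        linear_combination h' - this

lemma five {F U : Type*} [Field F] [Fintype F] (hF : 3 ≤ Fintype.card F) [AddCommGroup U]
    [Module F U] (e1 e2 e3 e4 e5 : U)
    (h12 : ∀ u : U, ∃ s t : F, u = s • e1 + t • e2)
    (h23 : ∀ u : U, ∃ s t : F, u = s • e2 + t • e3)
    (h34 : ∀ u : U, ∃ s t : F, u = s • e3 + t • e4)
    (h45 : ∀ u : U, ∃ s t : F, u = s • e4 + t • e5) (w : U) :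
    ∃ y1 y2 y3 y4 y5 : F, y1 ≠ 0 ∧ y2 ≠ 0 ∧ y3 ≠ 0 ∧ y4 ≠ 0 ∧ y5 ≠ 0 ∧
      y1 • e1 + y2 • e2 + y3 • e3 + y4 • e4 + y5 • e5 = w := by
  by_cases hli : ∀ s t : F, s • e1 + t • e2 = 0 → s = 0 ∧ t = 0
  · have inj : ∀ s t s' t' : F, s • e1 + t • e2 = s' • e1 + t' • e2 → s = s' ∧ t = t' := by
      intro s t s' t' h
      have := hli (s - s') (t - t') (by
        rw [sub_smul, sub_smul, sub_add_sub_comm, h, sub_self])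
      exact ⟨sub_eq_zero.1 this.1, sub_eq_zero.1 this.2⟩
    obtain ⟨a3, b3, rfl⟩ := h12 e3
    obtain ⟨a4, b4, rfl⟩ := h12 e4
    obtain ⟨a5, b5, rfl⟩ := h12 e5
    obtain ⟨s, t, rfl⟩ := h12 w
    have ha3 : a3 ≠ 0 := by
      rintro rfl
      obtain ⟨p, q, h⟩ := h23 e1
      have := inj 1 0 0 (p + q * b3) (by linear_combination (norm := module) h)
      exact one_ne_zero this.1
    have det : ∀ a b c d : F, (∀ u : U, ∃ s t : F, u = s • (a • e1 + b • e2) +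
        t • (c • e1 + d • e2)) → a * d - c * b ≠ 0 := by
      intro a b c d h hd
      obtain ⟨p, q, hp⟩ := h e1
      obtain ⟨p', q', hp'⟩ := h e2
      obtain ⟨i1, i2⟩ := inj 1 0 (p * a + q * c) (p * b + q * d)
        (by linear_combination (norm := module) hp)
      obtain ⟨i3, i4⟩ := inj 0 1 (p' * a + q' * c) (p' * b + q' * d)
        (by linear_combination (norm := module) hp')
      apply one_ne_zero (α := F)
      have : (p * a + q * c) * (p' * b + q' * d) - (p * b + q * d) * (p' * a + q' * c)
        = (p * q' - q * p') * (a * d - c * b) := by ring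
      rw [← i1, ← i2, ← i3, ← i4, hd] at this
      simpa using this
    obtain ⟨y3, y4, y5, k3, k4, k5, k1, k2⟩ := plane_case hF a3 b3 a4 b4 a5 b5 s t ha3
      (det _ _ _ _ h34) (det _ _ _ _ h45)
    refine ⟨_, _, y3, y4, y5, k1, k2, k3, k4, k5, ?_⟩
    module
  · push Not at hli
    obtain ⟨s, t, h, hst⟩ := hli
    have hu : ∃ u : U, ∀ v : U, ∃ c : F, v = c • u := by
      by_cases hs : s = 0
      · have ht := hst hs
        subst hs
        have : e2 = 0 := by
          have h' : t • e2 = 0 := by simpa using h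
          exact (smul_eq_zero.1 h').resolve_left ht
        refine ⟨e1, fun v => ?_⟩
        obtain ⟨p, q, hp⟩ := h12 v
        exact ⟨p, by rw [hp, this]; simp⟩
      · refine ⟨e2, fun v => ?_⟩
        have : e1 = (- t / s) • e2 := by
          have h' : s • e1 = (-t) • e2 := by linear_combination (norm := module) h
          rw [div_eq_inv_mul, mul_smul, ← h', smul_smul, inv_mul_cancel₀ hs, one_smul]
        obtain ⟨p, q, hp⟩ := h12 v
        refine ⟨p * (- t / s) + q, ?_⟩
        rw [hp, this]
        module
    obtain ⟨u, hu⟩ := hu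
    by_cases hz : u = 0
    · have : ∀ v : U, v = 0 := fun v => by
        obtain ⟨c, hc⟩ := hu v
        rw [hc, hz, smul_zero]
      exact ⟨1, 1, 1, 1, 1, one_ne_zero, one_ne_zero, one_ne_zero, one_ne_zero, one_ne_zero,
        by rw [this w]; exact this _⟩
    · obtain ⟨t1, rfl⟩ := hu e1
      obtain ⟨t2, rfl⟩ := hu e2
      obtain ⟨t3, rfl⟩ := hu e3
      obtain ⟨t4, rfl⟩ := hu e4
      obtain ⟨t5, rfl⟩ := hu e5
      obtain ⟨r, rfl⟩ := hu w
      have nz : ∀ a b : F, (∀ v : U, ∃ s t : F, v = s • (a • u) + t • (b • u)) →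
          a ≠ 0 ∨ b ≠ 0 := by
        intro a b h'
        by_contra hcon
        push Not at hcon
        obtain ⟨s, t, h⟩ := h' u
        rw [hcon.1, hcon.2] at h
        exact hz (by simpa using h)
      obtain ⟨y1, y2, y3, y4, k1, k2, k3, k4, k⟩ := line_case hF t1 t2 t3 t4 (r - t5)
        (nz _ _ h12) (nz _ _ h34)
      refine ⟨y1, y2, y3, y4, 1, k1, k2, k3, k4, one_ne_zero, ?_⟩
      have : r = y1 * t1 + y2 * t2 + y3 * t3 + y4 * t4 + t5 := by rw [k]; ring
      rw [this]
      module

lemma path {F : Type*} [Field F] [Fintype F] (hF : 3 ≤ Fintype.card F) (α γ β : ℕ → F) (z : F)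
    (k : ℕ) : ∀ w : F, ∃ X Y : ℕ → F, X 0 = z ∧ Y 0 = z ∧ X (k + 1) ≠ Y (k + 1) ∧
      X (k + 2) = w ∧ Y (k + 2) = w ∧
      (∀ i ≤ k, X (i + 1) ≠ α i * X i + γ i * X (i + 2) + β i) ∧
      (∀ i ≤ k, Y (i + 1) ≠ α i * Y i + γ i * Y (i + 2) + β i) := by
  induction k with
  | zero =>
    intro w
    obtain ⟨p, hp, -⟩ := avoid2 hF (α 0 * z + γ 0 * w + β 0) 0
    obtain ⟨q, hq, hqp⟩ := avoid2 hF (α 0 * z + γ 0 * w + β 0) p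
    refine ⟨fun i => if i = 0 then z else if i = 1 then p else w,
      fun i => if i = 0 then z else if i = 1 then q else w, ?_⟩
    simp [hp, hq, hqp.symm]
  | succ k ih =>
    intro w
    -- it suffices to produce, for all `t` (but one), a good sequence
    have main : ∀ t : F, (α (k + 1) ≠ 0 ∨ t ≠ γ (k + 1) * w + β (k + 1)) →
        ∃ X : ℕ → F, X 0 = z ∧ X (k + 2) = t ∧ X (k + 3) = w ∧
        (∀ i ≤ k + 1, X (i + 1) ≠ α i * X i + γ i * X (i + 2) + β i) := by
      intro t ht
      obtain ⟨X, Y, hX0, hY0, hne, hXt, hYt, hX, hY⟩ := ih t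
      have ext : ∀ X : ℕ → F, X 0 = z → X (k + 2) = t →
          (∀ i ≤ k, X (i + 1) ≠ α i * X i + γ i * X (i + 2) + β i) →
          t ≠ α (k + 1) * X (k + 1) + γ (k + 1) * w + β (k + 1) →
          ∃ X : ℕ → F, X 0 = z ∧ X (k + 2) = t ∧ X (k + 3) = w ∧
          (∀ i ≤ k + 1, X (i + 1) ≠ α i * X i + γ i * X (i + 2) + β i) := by
        intro X h0 h1 h2 h3
        refine ⟨fun i => if i = k + 3 then w else X i, by simp [h0], by simp [h1], by simp, ?_⟩
        intro i hi
        rcases Nat.lt_or_ge k i with h | h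
        · obtain rfl : i = k + 1 := by omega
          simpa [h1] using h3
        · have := h2 i h
          simpa [show i + 1 ≠ k + 3 by omega, show i ≠ k + 3 by omega,
            show i ≠ k + 1 by omega, show i ≠ k + 2 by omega] using this
      by_cases ha : α (k + 1) = 0
      · refine ext X hX0 hXt hX ?_
        rcases ht with h | h
        · exact absurd ha h
        · rw [ha]; simpa using h
      · by_cases hx : t = α (k + 1) * X (k + 1) + γ (k + 1) * w + β (k + 1)
        · refine ext Y hY0 hYt hY fun hy => hne ?_
          apply mul_left_cancel₀ ha
          linear_combination hy - hx
        · exact ext X hX0 hXt hX hx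
    obtain ⟨p, hp, -⟩ := avoid2 hF (γ (k + 1) * w + β (k + 1)) 0
    obtain ⟨q, hq, hqp⟩ := avoid2 hF (γ (k + 1) * w + β (k + 1)) p
    obtain ⟨X, x0, x1, x2, x3⟩ := main p (Or.inr hp)
    obtain ⟨Y, y0, y1, y2, y3⟩ := main q (Or.inr hq)
    exact ⟨X, Y, x0, y0, by rw [x1, y1]; exact hqp.symm, x2, y2, x3, y3⟩

open scoped Fin.NatCast Fin.CommRing

lemma row {m : ℕ} {F : Type*} [Field F] (a : Fin (m + 5) → Fin (m + 5) → F)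
    (ha : ∀ v u, ¬ (SimpleGraph.cycleGraph (m + 5)).Adj v u → a v u = 0)
    (x : Fin (m + 5) → F) (v : Fin (m + 5)) :
    ∑ u, a v u * x u = a v (v - 1) * x (v - 1) + a v (v + 1) * x (v + 1) := by
  have hne : v - 1 ≠ v + 1 := by
    intro h
    have h2 : (1 : Fin (m + 5)) + 1 = 0 := by
      have h' : v + 1 - (v - 1) = 0 := by rw [h]; abel
      rw [← h']; abel
    have := congrArg Fin.val h2
    simp [Fin.val_add] at this
    rw [Nat.mod_eq_of_lt (by omega)] at this
    omega
  rw [← Finset.sum_subset (Finset.subset_univ {v - 1, v + 1}), Finset.sum_pair hne]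
  intro u _ hu
  simp only [Finset.mem_insert, Finset.mem_singleton, not_or] at hu
  rw [ha v u, zero_mul]
  intro hadj
  rcases (SimpleGraph.cycleGraph_adj (n := m + 3)).1 hadj with h | h
  · exact hu.1 (by rw [← h]; abel)
  · exact hu.2 (by rw [← h]; abel)

lemma case_zero {m : ℕ} {F : Type*} [Field F] [Fintype F] (hF : 3 ≤ Fintype.card F)
    (a : Fin (m + 5) → Fin (m + 5) → F) (b : Fin (m + 5) → F)
    (v : Fin (m + 5)) (hv : a v (v + 1) = 0) :
    ∃ x : Fin (m + 5) → F, ∀ u,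
      x u ≠ a u (u - 1) * x (u - 1) + a u (u + 1) * x (u + 1) + b u := by
  have build : ∀ X : ℕ → F, X 0 = X (m + 5) →
      (∀ i ≤ m + 3, X (i + 1) ≠ a (v + (i + 1 : ℕ)) (v + (i : ℕ)) * X i
        + a (v + (i + 1 : ℕ)) (v + (i + 2 : ℕ)) * X (i + 2) + b (v + (i + 1 : ℕ))) →
      X 0 ≠ a v (v - 1) * X (m + 4) + b v →
      ∃ x : Fin (m + 5) → F, ∀ u,
        x u ≠ a u (u - 1) * x (u - 1) + a u (u + 1) * x (u + 1) + b u := by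
    intro X h0 h1 h2
    have hx : ∀ j : ℕ, j ≤ m + 5 → X (v + (j : Fin (m + 5)) - v).val = X j := by
      intro j hj
      rw [add_sub_cancel_left, Fin.val_natCast]
      rcases Nat.lt_or_ge j (m + 5) with h | h
      · rw [Nat.mod_eq_of_lt h]
      · obtain rfl : j = m + 5 := by omega
        rw [Nat.mod_self, h0]
    refine ⟨fun u => X (u - v).val, fun u => ?_⟩
    obtain ⟨j, hj, rfl⟩ : ∃ j : ℕ, j < m + 5 ∧ u = v + (j : Fin (m + 5)) :=
      ⟨(u - v).val, (u - v).isLt, by simp⟩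
    rcases j with _ | i
    · have e1 : v + ((0 : ℕ) : Fin (m + 5)) = v := by simp
      have e2 : v - 1 = v + ((m + 4 : ℕ) : Fin (m + 5)) := by
        have : ((m + 4 : ℕ) : Fin (m + 5)) + 1 = 0 := by
          have : ((m + 5 : ℕ) : Fin (m + 5)) = 0 := Fin.natCast_self _
          rw [← this]; push_cast; ring
        rw [sub_eq_iff_eq_add, add_assoc, this, add_zero]
      rw [e1, hv]
      have e3 := hx (m + 4) (by omega)
      rw [← e2] at e3
      simp only [e3, sub_self, Fin.val_zero, zero_mul, add_zero]
      exact h2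
    · have e1 : v + ((i + 1 : ℕ) : Fin (m + 5)) - 1 = v + (i : ℕ) := by push_cast; abel
      have e2 : v + ((i + 1 : ℕ) : Fin (m + 5)) + 1 = v + (i + 2 : ℕ) := by
        push_cast; ring
      rw [e1, e2]
      simp only [hx (i + 1) (by omega), hx i (by omega), hx (i + 2) (by omega)]
      exact h1 i (by omega)
  obtain ⟨z, hz, -⟩ := avoid2 hF (b v) 0
  obtain ⟨X, Y, hX0, hY0, hne, hXt, hYt, hX, hY⟩ := path hF
    (fun i => a (v + (i + 1 : ℕ)) (v + (i : ℕ))) (fun i => a (v + (i + 1 : ℕ)) (v + (i + 2 : ℕ)))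
    (fun i => b (v + (i + 1 : ℕ))) z (m + 3) z
  by_cases hx : z = a v (v - 1) * X (m + 4) + b v
  · refine build Y (by rw [hY0, hYt]) hY ?_
    rw [hY0]
    intro hy
    by_cases h0 : a v (v - 1) = 0
    · rw [h0] at hx
      exact hz (by simpa using hx)
    · apply hne
      apply mul_left_cancel₀ h0
      linear_combination hy - hx
  · exact build X (by rw [hX0, hXt]) hX (by rw [hX0]; exact hx)

lemma case_nonzero {m : ℕ} {F : Type*} [Field F] [Fintype F] (hF : 3 ≤ Fintype.card F)
    (a : Fin (m + 5) → Fin (m + 5) → F) (b : Fin (m + 5) → F)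
    (ha : ∀ v, a v (v + 1) ≠ 0) :
    ∃ x : Fin (m + 5) → F, ∀ u,
      x u ≠ a u (u - 1) * x (u - 1) + a u (u + 1) * x (u + 1) + b u := by
  classical
  let M : (Fin (m + 5) → F) →ₗ[F] (Fin (m + 5) → F) :=
    { toFun := fun x u => x u - (a u (u - 1) * x (u - 1) + a u (u + 1) * x (u + 1))
      map_add' := by intro x y; ext u; simp; ring
      map_smul' := by intro c x; ext u; simp; ring }
  let W := LinearMap.range M
  let e : Fin (m + 5) → ((Fin (m + 5) → F) ⧸ W) := fun v => W.mkQ (Pi.single v 1)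
  have rel : ∀ v, e v = a (v + 1) v • e (v + 1) + a (v - 1) v • e (v - 1) := by
    intro v
    have h : W.mkQ (M (Pi.single v 1)) = 0 := by
      rw [Submodule.mkQ_apply, Submodule.Quotient.mk_eq_zero]
      exact ⟨_, rfl⟩
    have h' : M (Pi.single v 1) = Pi.single v 1 - (a (v + 1) v • Pi.single (v + 1) 1
        + a (v - 1) v • Pi.single (v - 1) 1) := by
      ext u
      simp only [M, LinearMap.coe_mk, AddHom.coe_mk, Pi.sub_apply, Pi.add_apply, Pi.smul_apply,
        Pi.single_apply, smul_eq_mul]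
      have e1 : a u (u - 1) * (if u - 1 = v then 1 else 0)
          = a (v + 1) v * (if u = v + 1 then 1 else 0) := by
        by_cases h : u = v + 1
        · subst h; simp
        · rw [if_neg h, if_neg (fun h' => h (by rw [← h', sub_add_cancel]))]; simp
      have e2 : a u (u + 1) * (if u + 1 = v then 1 else 0)
          = a (v - 1) v * (if u = v - 1 then 1 else 0) := by
        by_cases h : u = v - 1
        · subst h; simp
        · rw [if_neg h, if_neg (fun h' => h (by rw [← h', add_sub_cancel_right]))]; simp
      rw [e1, e2]
    rw [h', map_sub, map_add, map_smul, map_smul, sub_eq_zero] at h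
    exact h
  have step : ∀ v, e v ∈ Submodule.span F {e (v + 1), e (v + 1 + 1)} := by
    intro v
    have h := rel (v + 1)
    rw [add_sub_cancel_right] at h
    have : e v = (a v (v + 1))⁻¹ • (e (v + 1) - a (v + 1 + 1) (v + 1) • e (v + 1 + 1)) := by
      rw [eq_inv_smul_iff₀ (ha v), eq_sub_iff_add_eq]
      exact (add_comm _ _).trans h.symm
    rw [this]
    exact Submodule.smul_mem _ _ (Submodule.sub_mem _ (Submodule.subset_span (by simp))
      (Submodule.smul_mem _ _ (Submodule.subset_span (by simp))))
  have all : ∀ v, ∀ k : ℕ, e (v - k) ∈ Submodule.span F {e v, e (v + 1)} ∧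
      e (v - k + 1) ∈ Submodule.span F {e v, e (v + 1)} := by
    intro v k
    induction k with
    | zero => exact ⟨Submodule.subset_span (by simp), Submodule.subset_span (by simp)⟩
    | succ k ih =>
      have e1 : v - ((k + 1 : ℕ) : Fin (m + 5)) + 1 = v - k := by push_cast; abel
      rw [e1]
      refine ⟨?_, ih.1⟩
      have h := step (v - ((k + 1 : ℕ) : Fin (m + 5)))
      rw [e1] at h
      refine Submodule.span_le.2 ?_ h
      rintro y (rfl | rfl)
      · exact ih.1
      · exact ih.2
  have span : ∀ v, ∀ u, ∃ s t : F, u = s • e v + t • e (v + 1) := by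
    intro v u
    have hu : u ∈ Submodule.span F {e v, e (v + 1)} := by
      obtain ⟨y, rfl⟩ := W.mkQ_surjective u
      rw [pi_eq_sum_univ' y, map_sum]
      refine Submodule.sum_mem _ fun w _ => ?_
      rw [map_smul]
      refine Submodule.smul_mem _ _ ?_
      have h := (all v (v - w).val).1
      rw [Fin.cast_val_eq_self, sub_sub_cancel] at h
      convert h using 2
    obtain ⟨s, t, h⟩ := Submodule.mem_span_pair.1 hu
    exact ⟨s, t, h.symm⟩
  let r : Fin (m + 5) → F := fun u => if u.val < 5 then 0 else 1
  obtain ⟨y1, y2, y3, y4, y5, k1, k2, k3, k4, k5, k⟩ := five hF (e 0) (e (0 + 1)) (e (0 + 1 + 1))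
    (e (0 + 1 + 1 + 1)) (e (0 + 1 + 1 + 1 + 1)) (span _) (span _) (span _) (span _)
    (W.mkQ (-b - r))
  have z1 : (0 + 1 : Fin (m + 5)) = ⟨1, by omega⟩ := by ext; simp
  have z2 : (0 + 1 + 1 : Fin (m + 5)) = ⟨2, by omega⟩ := by rw [z1]; ext; simp [Fin.val_add]
  have z3 : (0 + 1 + 1 + 1 : Fin (m + 5)) = ⟨3, by omega⟩ := by rw [z2]; ext; simp [Fin.val_add]
  have z4 : (0 + 1 + 1 + 1 + 1 : Fin (m + 5)) = ⟨4, by omega⟩ := by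
    rw [z3]; ext; simp [Fin.val_add]
  rw [z4, z3, z2, z1] at k
  let y : Fin (m + 5) → F := r + (y1 • Pi.single 0 1 + y2 • Pi.single ⟨1, by omega⟩ 1
    + y3 • Pi.single ⟨2, by omega⟩ 1 + y4 • Pi.single ⟨3, by omega⟩ 1
    + y5 • Pi.single ⟨4, by omega⟩ 1)
  have hy : ∀ u, y u ≠ 0 := by
    rintro ⟨u, hu⟩
    simp only [y, r, Pi.add_apply, Pi.smul_apply, Pi.single_apply, Fin.ext_iff, Fin.val_zero,
      smul_eq_mul]
    rcases u with _ | _ | _ | _ | _ | u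
    · simpa using k1
    · simpa using k2
    · simpa using k3
    · simpa using k4
    · simpa using k5
    · simp
  have hmem : y + b ∈ W := by
    rw [← Submodule.Quotient.mk_eq_zero, ← Submodule.mkQ_apply]
    have : W.mkQ y = W.mkQ r + W.mkQ (-b - r) := by
      rw [← k]
      simp only [y, map_add, map_smul, e]
    rw [map_add, this, ← map_add, ← map_add]
    have : r + (-b - r) + b = 0 := by ring
    rw [this, map_zero]
  obtain ⟨x, hx⟩ := hmem
  refine ⟨x, fun u h => hy u ?_⟩
  have := congrFun hx u
  simp only [M, LinearMap.coe_mk, AddHom.coe_mk, Pi.add_apply] at this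
  linear_combination h - this

end HatCycle

/-- For every `n ≥ 5` and every finite field with at least `3` elements, the cycle `C_n`
admits no winning linear guessing strategy; i.e. `HG_lin(C_n) ≤ 2`. -/
theorem stmt7 (n : ℕ) (hn : 5 ≤ n) (F : Type*) [Field F] [Fintype F]
    (hF : 3 ≤ Fintype.card F) :
    ¬ LinearSolvable (SimpleGraph.cycleGraph n).Adj F := by
  obtain ⟨m, rfl⟩ : ∃ m, n = m + 5 := ⟨n - 5, by omega⟩
  rintro ⟨a, b, ha, hw⟩
  have : ∃ x : Fin (m + 5) → F, ∀ u,
      x u ≠ a u (u - 1) * x (u - 1) + a u (u + 1) * x (u + 1) + b u := by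
    by_cases h : ∃ v, a v (v + 1) = 0
    · obtain ⟨v, hv⟩ := h
      exact HatCycle.case_zero hF a b v hv
    · push Not at h
      exact HatCycle.case_nonzero hF a b h
  obtain ⟨x, hx⟩ := this
  obtain ⟨v, hv⟩ := hw x
  rw [HatCycle.row a ha] at hv
  exact hx v hv
end

section
/- Let q = p^k be a proper prime power, i.e., p is a prime and k ≥ 2. Then for every positive integer n, the complete bipartite graph K_{n,n} is not linearly q-solvable. -/
open MvPolynomial in
theorem aux_coeff {F σ τ : Type*} [Field F] [Fintype τ] [DecidableEq τ] (l : τ → MvPolynomial σ F)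
    (hl : ∀ j, (l j).IsHomogeneous 1) (c : τ → F) (t : σ →₀ ℕ) (ht : t.degree = Fintype.card τ) :
    coeff t (∏ j, (l j + C (c j))) = coeff t (∏ j, l j) := by
  rw [Finset.prod_add, coeff_sum, Finset.sum_eq_single Finset.univ]
  · simp
  · intro s _ hs
    apply coeff_eq_zero_of_totalDegree_lt
    change _ < t.degree
    rw [ht]
    have h1 : s.card < Fintype.card τ := Finset.card_lt_card (Finset.ssubset_univ_iff.2 hs)
    refine lt_of_le_of_lt ?_ h1
    rw [← map_prod]
    refine (totalDegree_mul _ _).trans ?_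
    rw [totalDegree_C, add_zero]
    have := (IsHomogeneous.prod s l (fun _ => 1) (fun i _ => hl i)).totalDegree_le
    simpa using this
  · simp

open MvPolynomial in
theorem aux_exists {F σ τ : Type*} [Field F] [Fintype σ] [Fintype τ] [DecidableEq τ] [Finite F]
    (p : ℕ) [Fact p.Prime] [CharP F p]
    (l : τ → MvPolynomial σ F)
    (hl : ∀ j, (l j).IsHomogeneous 1) (s : σ → τ → F)
    (hs : ∀ j, aeval (fun i => ∑ k, C (s i k) * (X k : MvPolynomial τ F)) (l j) = X j)
    (c : τ → F) (S : σ → Finset F) (hS : ∀ i, p ≤ (S i).card) :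
    ∃ w : σ → F, (∀ i, w i ∈ S i) ∧ ∀ j, eval w (l j) + c j ≠ 0 := by
  have hp : p.Prime := Fact.out
  obtain ⟨t, ht, htp⟩ : ∃ t, coeff t (∏ j, l j) ≠ 0 ∧ ∀ i, t i < p := by
    by_contra! H
    have hmem : (∏ j, l j) ∈ Ideal.span (Set.image (fun m => monomial m (1 : F)) (Set.range fun i : σ => Finsupp.single i p)) := by
      rw [mem_ideal_span_monomial_image]
      intro x hx
      obtain ⟨i, hi⟩ := H x (mem_support_iff.1 hx)
      exact ⟨_, ⟨i, rfl⟩, by simpa using hi⟩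
    have hle : Ideal.span (Set.image (fun m => monomial m (1 : F)) (Set.range fun i : σ => Finsupp.single i p)) ≤
        (Ideal.span (Set.image (fun m => monomial m (1 : F)) (Set.range fun i : τ => Finsupp.single i p))).comap
        (aeval (fun i => ∑ k, C (s i k) * (X k : MvPolynomial τ F)) :
          MvPolynomial σ F →ₐ[F] MvPolynomial τ F) := by
      rw [Ideal.span_le]
      rintro _ ⟨_, ⟨i, rfl⟩, rfl⟩
      have e : (monomial (Finsupp.single i p) (1 : F)) = X i ^ p := by
        rw [X_pow_eq_monomial]
      simp only [SetLike.mem_coe, Ideal.mem_comap, e, map_pow, aeval_X]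
      rw [sum_pow_char]
      refine Ideal.sum_mem _ fun k _ => ?_
      rw [mul_pow]
      refine Ideal.mul_mem_left _ _ (Ideal.subset_span ⟨_, ⟨k, rfl⟩, ?_⟩)
      simp [X_pow_eq_monomial]
    have h2 := hle hmem
    rw [Ideal.mem_comap, map_prod, Finset.prod_congr rfl (fun j _ => hs j),
      mem_ideal_span_monomial_image] at h2
    have e2 : (∏ j, (X j : MvPolynomial τ F)) = monomial (∑ j, Finsupp.single j 1) 1 := by
      rw [monomial_sum_one]; rfl
    obtain ⟨_, ⟨i, rfl⟩, hi⟩ := h2 (∑ j, Finsupp.single j 1) (by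
      rw [e2, mem_support_iff]; simp)
    have := hi i
    simp [Finsupp.finsetSum_apply, Finsupp.single_apply] at this
    have := hp.two_le
    omega
  have hom := IsHomogeneous.prod Finset.univ l (fun _ => 1) (fun i _ => hl i)
  have hdeg : t.degree = Fintype.card τ := by
    by_contra h
    exact ht (hom.coeff_eq_zero (by simpa using h))
  have hc : coeff t (∏ j, (l j + C (c j))) ≠ 0 := by rwa [aux_coeff l hl c t hdeg]
  have htd : (∏ j, (l j + C (c j))).totalDegree = t.degree := by
    apply le_antisymm
    · refine (totalDegree_finsetProd _ _).trans ?_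
      rw [hdeg]
      refine (Finset.sum_le_card_nsmul _ _ 1 fun j _ => ?_).trans (by simp)
      refine (totalDegree_add _ _).trans ?_
      simpa using (hl j).totalDegree_le
    · exact le_totalDegree (mem_support_iff.2 hc)
  obtain ⟨w, hw, hne⟩ := combinatorial_nullstellensatz_exists_eval_nonzero _ t hc htd S
    (fun i => (htp i).trans_le (hS i))
  refine ⟨w, hw, fun j => ?_⟩
  rw [map_prod, Finset.prod_ne_zero_iff] at hne
  simpa using hne j (Finset.mem_univ _)

open MvPolynomial in
/-- For a proper prime power `q = p^k` (`p` prime, `k ≥ 2`), the complete bipartite graph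
`K_{n,n}` is not linearly `q`-solvable for any `n ≥ 1`.  The field of order `q` is
formalized as a finite field `F` with `Fintype.card F = p ^ k`. -/
theorem stmt8 (p k : ℕ) (hp : p.Prime) (hk : 2 ≤ k)
    (F : Type*) [Field F] [Fintype F] (hF : Fintype.card F = p ^ k)
    (n : ℕ) (hn : 1 ≤ n) :
    ¬ LinearSolvable (completeBipartiteGraph (Fin n) (Fin n)).Adj F := by
  classical
  rintro ⟨a, b, h0, hwin⟩
  haveI : Fact p.Prime := ⟨hp⟩
  haveI : CharP F p := charP_of_card_eq_prime_pow hF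
  have hlt : p < Fintype.card F := by
    rw [hF]
    exact lt_self_pow₀ hp.one_lt (by omega)
  have hll : ∀ i j : Fin n, a (Sum.inl i) (Sum.inl j) = 0 := fun i j => h0 _ _ (by simp)
  have hrr : ∀ i j : Fin n, a (Sum.inr i) (Sum.inr j) = 0 := fun i j => h0 _ _ (by simp)
  obtain ⟨w, hw, hne⟩ := aux_exists (F := F) (σ := Fin n ⊕ Fin n) (τ := Fin n) p
    (fun j => X (Sum.inr j) - ∑ i, C (a (Sum.inr j) (Sum.inl i)) *
      (X (Sum.inl i) + ∑ m, C (a (Sum.inl i) (Sum.inr m)) * X (Sum.inr m)))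
    (fun j => by
      refine (isHomogeneous_X _ _).sub (IsHomogeneous.sum _ _ _ fun i _ => ?_)
      refine IsHomogeneous.C_mul ((isHomogeneous_X _ _).add (IsHomogeneous.sum _ _ _ fun m _ => ?_)) _
      exact (isHomogeneous_X _ _).C_mul _)
    (fun i m => Sum.elim (fun i => - a (Sum.inl i) (Sum.inr m))
      (fun j => if j = m then 1 else 0) i)
    (fun j => by
      simp [MvPolynomial.algebraMap_eq, ite_mul])
    (fun j => - b (Sum.inr j))
    (Sum.elim (fun i => Finset.univ.erase (b (Sum.inl i))) (fun _ => Finset.univ))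
    (by
      rintro (i | i)
      · simp [Finset.card_erase_of_mem]; omega
      · simp; omega)
  obtain ⟨v, hv⟩ := hwin (Sum.elim
    (fun i => w (Sum.inl i) + ∑ m, a (Sum.inl i) (Sum.inr m) * w (Sum.inr m))
    (fun j => w (Sum.inr j)))
  rcases v with i | j
  · have := hw (Sum.inl i)
    simp at this
    simp [hll] at hv
    exact this (by linear_combination hv)
  · have := hne j
    simp at this
    simp [hrr] at hv
    exact this (by linear_combination hv)
end
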